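/- Let 0 ≤ k ≤ i − 1. The set of all subspaces of V of the form range(Π(S, χ)), where S is the preimage of a totally singular (i−k)-dimensional subspace S̄ of 𝔽₂^i × 𝔽₂^i and χ : S → {1, −1} is a group homomorphism with χ(−I) = −1, consists of 2^k-dimensional subspaces and has cardinality N = 2^{i−k} · [i choose k]₂ · Π_{j=k}^{i−1} (2^j + 1), where [i choose k]₂ is the Gaussian binomial coefficient (2^i − 1)⋯(2^{i−k+1} − 1)/((2^k − 1)⋯(2 − 1)). -/

import Mathlib

open Matrix BigOperators

/-- `U i = 𝔽₂^i`. -/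
abbrev U (i : ℕ) := Fin i → ZMod 2

/-- Standard inner product on `𝔽₂^i`. -/
def dotp {i : ℕ} (a b : U i) : ZMod 2 := ∑ j, a j * b j

/-- The matrix of the map `X(a) : e_u ↦ e_{u+a}`. -/
def XM {i : ℕ} (a : U i) : Matrix (U i) (U i) ℝ :=
  fun w u => if w = u + a then 1 else 0

/-- The matrix of the map `Y(b) : e_u ↦ (−1)^{b·u} e_u`. -/
def YM {i : ℕ} (b : U i) : Matrix (U i) (U i) ℝ :=
  Matrix.diagonal (fun u => (-1 : ℝ) ^ (dotp b u).val)

/-- The averaged operator `Π(S, χ) = (1/|S|) Σ_{g∈S} χ(g)·g`. -/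
noncomputable def PiMat {i : ℕ} (S : Subgroup (Matrix (U i) (U i) ℝ)ˣ)
    (χ : S →* ℝˣ) : Matrix (U i) (U i) ℝ :=
  (Nat.card S : ℝ)⁻¹ • ∑ᶠ g : S, (χ g : ℝ) • ((g : (Matrix (U i) (U i) ℝ)ˣ) : Matrix (U i) (U i) ℝ)

/-- A subspace of `𝔽₂^i × 𝔽₂^i` is totally singular for `Q(a,b) = a·b` if
    `a·b = 0` for all its elements. -/
def TotSing {i : ℕ} (S : Submodule (ZMod 2) (U i × U i)) : Prop :=
  ∀ p ∈ S, dotp p.1 p.2 = 0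

/-- The preimage in `E` of a subspace `S̄ ⊆ 𝔽₂^i × 𝔽₂^i`, i.e. the subgroup
    `{ε·X(a)Y(b) : ε = ±1, (a,b) ∈ S̄}`. -/
def preim {i : ℕ} (S : Submodule (ZMod 2) (U i × U i)) :
    Subgroup (Matrix (U i) (U i) ℝ)ˣ :=
  Subgroup.closure
    {g : (Matrix (U i) (U i) ℝ)ˣ |
      ∃ a b : U i, (a, b) ∈ S ∧
        ((g : Matrix (U i) (U i) ℝ) = XM a * YM b ∨
         (g : Matrix (U i) (U i) ℝ) = -(XM a * YM b))}

/-- The squared Frobenius norm of a real matrix. -/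
def frobSq {n : Type*} [Fintype n] (A : Matrix n n ℝ) : ℝ :=
  ∑ u, ∑ v, (A u v) ^ 2

section

variable {i : ℕ}

/-- The sign `(-1)^x` of `x : ZMod 2`. -/
def sg (x : ZMod 2) : ℝ := (-1) ^ x.val

lemma zmod_two_cases (x : ZMod 2) : x = 0 ∨ x = 1 := by
  revert x
  decide

@[simp] lemma sg_zero : sg 0 = 1 := by simp [sg]

@[simp] lemma sg_one : sg 1 = -1 := by simp [sg, ZMod.val_one]

lemma sg_add (x y : ZMod 2) : sg (x + y) = sg x * sg y := by
  have h : (1 + 1 : ZMod 2) = 0 := by decide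
  rcases zmod_two_cases x with rfl | rfl <;> rcases zmod_two_cases y with rfl | rfl <;> simp [h]

@[simp] lemma sg_mul_self (x : ZMod 2) : sg x * sg x = 1 := by
  rw [← sg_add, CharTwo.add_self_eq_zero, sg_zero]

lemma sg_eq_one_or (x : ZMod 2) : sg x = 1 ∨ sg x = -1 := by
  rcases zmod_two_cases x with rfl | rfl <;> simp

lemma sg_ne_zero (x : ZMod 2) : sg x ≠ 0 := by
  rcases sg_eq_one_or x with h | h <;> simp [h]

lemma sg_injective : Function.Injective sg := by
  intro x y h
  rcases zmod_two_cases x with rfl | rfl <;> rcases zmod_two_cases y with rfl | rfl <;>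
    first | rfl | norm_num at h

/-- A nontrivial additive character of a finite group sums to zero. -/
lemma sum_sg_eq_zero {M : Type*} [AddCommGroup M] [Fintype M] (φ : M →+ ZMod 2) {x : M}
    (hx : φ x ≠ 0) : ∑ y, sg (φ y) = 0 := by
  have h1 : φ x = 1 := (zmod_two_cases _).resolve_left hx
  have h : ∑ y, sg (φ y) = ∑ y, sg (φ (x + y)) :=
    (Fintype.sum_equiv (Equiv.addLeft x) _ _ fun _ => rfl).symm
  simp only [map_add, sg_add, h1, sg_one, neg_mul, one_mul, Finset.sum_neg_distrib] at h
  linarith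

lemma dotp_add_left (a b c : U i) : dotp (a + b) c = dotp a c + dotp b c :=
  add_dotProduct a b c

lemma dotp_add_right (a b c : U i) : dotp a (b + c) = dotp a b + dotp a c :=
  dotProduct_add a b c

lemma dotp_smul_left (x : ZMod 2) (a b : U i) : dotp (x • a) b = x * dotp a b :=
  smul_dotProduct x a b

lemma dotp_smul_right (x : ZMod 2) (a b : U i) : dotp a (x • b) = x * dotp a b :=
  dotProduct_smul x a b

lemma dotp_comm (a b : U i) : dotp a b = dotp b a := dotProduct_comm a b

@[simp] lemma dotp_zero_left (a : U i) : dotp 0 a = 0 := zero_dotProduct a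

@[simp] lemma dotp_zero_right (a : U i) : dotp a 0 = 0 := dotProduct_zero a

lemma exists_dotp_ne_zero {a : U i} (ha : a ≠ 0) : ∃ b, dotp a b ≠ 0 := by
  by_contra! h
  exact ha (dotProduct_eq_zero a h)

lemma sum_sg_dotp (a : U i) : ∑ b, sg (dotp a b) = if a = 0 then 2 ^ i else 0 := by
  split_ifs with ha
  · subst ha
    simp [ZMod.card]
  · obtain ⟨b, hb⟩ := exists_dotp_ne_zero ha
    exact sum_sg_eq_zero (AddMonoidHom.mk' (dotp a) (dotp_add_right a)) (x := b) hb

/-- The signed permutation matrix `X(a)Y(b)` for `p = (a, b)`. -/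
def pauli (p : U i × U i) : Matrix (U i) (U i) ℝ := XM p.1 * YM p.2

lemma pauli_apply (p : U i × U i) (w u : U i) :
    pauli p w u = if w = u + p.1 then sg (dotp p.2 u) else 0 := by
  simp [pauli, YM, XM, Matrix.mul_diagonal, sg]

@[simp] lemma pauli_zero : pauli (0 : U i × U i) = 1 := by
  ext w u
  simp [pauli_apply, Matrix.one_apply]

lemma pauli_mul (p q : U i × U i) :
    pauli p * pauli q = sg (dotp p.2 q.1) • pauli (p + q) := by
  ext w u
  rw [Matrix.mul_apply, Finset.sum_eq_single (u + q.1)]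
  · simp only [pauli_apply, Matrix.smul_apply, smul_eq_mul, if_true, Prod.fst_add, Prod.snd_add,
      dotp_add_left, dotp_add_right, sg_add]
    rw [show u + q.1 + p.1 = u + (p.1 + q.1) by abel]
    split_ifs <;> ring
  · intro v _ hv
    simp [pauli_apply, hv]
  · simp

lemma prod_add_self (p : U i × U i) : p + p = 0 := by
  ext <;> simp [CharTwo.add_self_eq_zero]

lemma pauli_transpose (p : U i × U i) : (pauli p)ᵀ = sg (dotp p.1 p.2) • pauli p := by
  ext w u
  simp only [pauli_apply, Matrix.transpose_apply, Matrix.smul_apply, smul_eq_mul]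
  have h2 : p.1 + p.1 = 0 := by ext; simp [CharTwo.add_self_eq_zero]
  by_cases h : w = u + p.1
  · have h' : u = w + p.1 := by rw [h, add_assoc, h2, add_zero]
    rw [if_pos h, if_pos h', h, dotp_add_right, sg_add, dotp_comm p.1 p.2, mul_comm]
  · have h' : u ≠ w + p.1 := fun h' => h (by rw [h', add_assoc, h2, add_zero])
    rw [if_neg h, if_neg h', mul_zero]

lemma trace_pauli (p : U i × U i) : (pauli p).trace = if p = 0 then 2 ^ i else 0 := by
  simp only [Matrix.trace, Matrix.diag, pauli_apply, left_eq_add]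
  by_cases h : p.1 = 0
  · simp only [h, if_true, sum_sg_dotp, Prod.ext_iff, Prod.fst_zero, Prod.snd_zero, true_and]
  · simp [h, Prod.ext_iff]

lemma trace_pauli_mul (p q : U i × U i) :
    (pauli p * pauli q).trace = if p = q then sg (dotp p.2 p.1) * 2 ^ i else 0 := by
  rw [pauli_mul, Matrix.trace_smul, trace_pauli]
  by_cases h : p = q
  · subst h
    simp [prod_add_self]
  · have : p + q ≠ 0 := fun h' => h (by
      rw [← add_zero p, ← prod_add_self q, ← add_assoc, h', zero_add])
    simp [h, this]

/-- `pauli p` as an invertible matrix. -/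
def pauliUnit (p : U i × U i) : (Matrix (U i) (U i) ℝ)ˣ where
  val := pauli p
  inv := sg (dotp p.2 p.1) • pauli p
  val_inv := by
    rw [Matrix.mul_smul, pauli_mul, smul_smul, sg_mul_self, prod_add_self, pauli_zero, one_smul]
  inv_val := by
    rw [Matrix.smul_mul, pauli_mul, smul_smul, sg_mul_self, prod_add_self, pauli_zero, one_smul]

/-- The sign `(-1)^x` as a unit. -/
noncomputable def sgUnit (x : ZMod 2) : ℝˣ := Units.mk0 (sg x) (sg_ne_zero x)

/-- The signed element `(-1)^x pauli p` as an invertible matrix. -/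
noncomputable def signedPauli (x : ZMod 2) (p : U i × U i) : (Matrix (U i) (U i) ℝ)ˣ :=
  sgUnit x • pauliUnit p

lemma signedPauli_val (x : ZMod 2) (p : U i × U i) :
    (signedPauli x p : Matrix (U i) (U i) ℝ) = sg x • pauli p := rfl

lemma signedPauli_mul (x y : ZMod 2) (p q : U i × U i) :
    signedPauli x p * signedPauli y q = signedPauli (x + y + dotp p.2 q.1) (p + q) := by
  ext1
  simp only [Units.val_mul, signedPauli_val, Matrix.smul_mul, Matrix.mul_smul, pauli_mul,
    smul_smul, sg_add]
  rw [mul_left_comm, mul_assoc]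

lemma signedPauli_zero : signedPauli (i := i) 0 0 = 1 := by
  ext1
  simp [signedPauli_val]

lemma smul_pauli_injective {x y : ℝ} {p q : U i × U i} (hx : x ≠ 0)
    (h : x • pauli p = y • pauli q) : p = q ∧ x = y := by
  have h2 := congrArg (fun A => (pauli p * A).trace) h
  simp only [Matrix.mul_smul, Matrix.trace_smul, trace_pauli_mul, if_true, smul_eq_mul] at h2
  have h3 := sg_ne_zero (dotp p.2 p.1)
  have h4 : (2 : ℝ) ^ i ≠ 0 := by positivity
  by_cases hpq : p = q
  · rw [if_pos hpq] at h2
    exact ⟨hpq, mul_right_cancel₀ (mul_ne_zero h3 h4) h2⟩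
  · simp [hpq, hx, h3, h4] at h2

lemma signedPauli_injective {x y : ZMod 2} {p q : U i × U i}
    (h : signedPauli x p = signedPauli y q) : x = y ∧ p = q := by
  have h' := smul_pauli_injective (sg_ne_zero x) (congrArg Units.val h)
  exact ⟨sg_injective h'.2, h'.1⟩

lemma signedPauli_mem {S : Submodule (ZMod 2) (U i × U i)} (x : ZMod 2) {p : U i × U i}
    (hp : p ∈ S) : signedPauli x p ∈ preim S := by
  refine Subgroup.subset_closure ⟨p.1, p.2, hp, ?_⟩
  rw [signedPauli_val]
  rcases sg_eq_one_or x with h | h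
  · left; rw [h, one_smul]; rfl
  · right; rw [h, neg_one_smul]; rfl

lemma mem_preim_iff {S : Submodule (ZMod 2) (U i × U i)} {g : (Matrix (U i) (U i) ℝ)ˣ} :
    g ∈ preim S ↔ ∃ x, ∃ p ∈ S, g = signedPauli x p := by
  constructor
  · intro hg
    induction hg using Subgroup.closure_induction with
    | mem g hg =>
      obtain ⟨a, b, hab, h | h⟩ := hg
      · exact ⟨0, (a, b), hab, by ext1; rw [signedPauli_val, sg_zero, one_smul, h]; rfl⟩
      · exact ⟨1, (a, b), hab, by ext1; rw [signedPauli_val, sg_one, neg_one_smul, h]; rfl⟩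
    | one => exact ⟨0, 0, S.zero_mem, signedPauli_zero.symm⟩
    | mul g h _ _ hg hh =>
      obtain ⟨x, p, hp, rfl⟩ := hg
      obtain ⟨y, q, hq, rfl⟩ := hh
      exact ⟨_, p + q, S.add_mem hp hq, signedPauli_mul x y p q⟩
    | inv g _ hg =>
      obtain ⟨x, p, hp, rfl⟩ := hg
      refine ⟨x + dotp p.2 p.1, p, hp, inv_eq_of_mul_eq_one_left ?_⟩
      rw [signedPauli_mul, prod_add_self, ← signedPauli_zero]
      congr 1
      linear_combination CharTwo.add_self_eq_zero x + CharTwo.add_self_eq_zero (dotp p.2 p.1)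
  · rintro ⟨x, p, hp, rfl⟩
    exact signedPauli_mem x hp

noncomputable instance (S : Submodule (ZMod 2) (U i × U i)) : Fintype S := Fintype.ofFinite S

lemma card_submodule (S : Submodule (ZMod 2) (U i × U i)) :
    Nat.card S = 2 ^ Module.finrank (ZMod 2) S := by
  rw [Module.natCard_eq_pow_finrank (K := ZMod 2), Nat.card_zmod]

/-- The functions `f` on `S` such that `p ↦ (-1)^(f p) pauli p` is multiplicative. -/
abbrev SignFn (S : Submodule (ZMod 2) (U i × U i)) : Type :=
  {f : S → ZMod 2 // ∀ p q : S, f (p + q) = f p + f q + dotp p.1.2 q.1.1}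

/-- The average of the elements `(-1)^(f p) pauli p` over `p ∈ S`. -/
noncomputable def projMat (S : Submodule (ZMod 2) (U i × U i)) (f : SignFn S) :
    Matrix (U i) (U i) ℝ :=
  (Nat.card S : ℝ)⁻¹ • ∑ p : S, sg (f.1 p) • pauli p.1

section projMat

variable {S : Submodule (ZMod 2) (U i × U i)}

lemma SignFn.map_zero (f : SignFn S) : f.1 0 = 0 := by
  have h := f.2 0 0
  simpa using h

lemma card_ne_zero (S : Submodule (ZMod 2) (U i × U i)) : (Nat.card S : ℝ) ≠ 0 := by
  simp

lemma pauli_mul_projMat (f : SignFn S) (p : S) :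
    pauli p.1 * projMat S f = sg (f.1 p) • projMat S f := by
  rw [projMat, Matrix.mul_smul, smul_comm, Finset.mul_sum]
  congr 1
  rw [Finset.smul_sum]
  refine Fintype.sum_equiv (Equiv.addLeft p) _ _ fun q => ?_
  rw [Matrix.mul_smul, pauli_mul, smul_smul, smul_smul, Equiv.coe_addLeft, f.2, sg_add, sg_add,
    ← mul_assoc, ← mul_assoc, sg_mul_self, one_mul]
  rfl

lemma projMat_mul_self (f : SignFn S) : projMat S f * projMat S f = projMat S f := by
  nth_rewrite 1 [projMat]
  rw [Matrix.smul_mul, Finset.sum_mul]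
  simp only [Matrix.smul_mul, pauli_mul_projMat, smul_smul, sg_mul_self, one_smul]
  rw [Finset.sum_const, Finset.card_univ, ← Nat.card_eq_fintype_card, ← Nat.cast_smul_eq_nsmul ℝ,
    smul_smul, inv_mul_cancel₀ (card_ne_zero S), one_smul]

lemma projMat_transpose (hS : TotSing S) (f : SignFn S) : (projMat S f)ᵀ = projMat S f := by
  simp only [projMat, Matrix.transpose_smul, Matrix.transpose_sum, pauli_transpose]
  congr 1
  refine Finset.sum_congr rfl fun p _ => ?_
  rw [hS p.1 p.2, sg_zero, one_smul]

lemma trace_projMat (f : SignFn S) : (projMat S f).trace = 2 ^ i / Nat.card S := by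
  rw [projMat, Matrix.trace_smul, Matrix.trace_sum, Finset.sum_eq_single 0]
  · simp [f.map_zero, div_eq_inv_mul]
  · intro p _ hp
    have : p.1 ≠ 0 := fun h => hp (Subtype.ext h)
    simp [trace_pauli, this]
  · simp

open Classical in
lemma trace_pauli_mul_projMat (f : SignFn S) (q : U i × U i) :
    (pauli q * projMat S f).trace * Nat.card S =
      if h : q ∈ S then sg (dotp q.2 q.1) * 2 ^ i * sg (f.1 ⟨q, h⟩) else 0 := by
  have hc := card_ne_zero S
  rw [projMat, Matrix.mul_smul, Matrix.trace_smul, smul_eq_mul, inv_mul_eq_div,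
    div_mul_cancel₀ _ hc, Finset.mul_sum, Matrix.trace_sum]
  simp only [Matrix.mul_smul, Matrix.trace_smul, trace_pauli_mul, smul_eq_mul]
  split_ifs with h
  · rw [Finset.sum_eq_single ⟨q, h⟩]
    · simp [mul_comm]
    · intro p _ hp
      rw [if_neg, mul_zero]
      rintro rfl
      exact hp rfl
    · simp
  · refine Finset.sum_eq_zero fun p _ => ?_
    rw [if_neg, mul_zero]
    rintro rfl
    exact h p.2

lemma finrank_range_projMat (f : SignFn S) :
    (Module.finrank ℝ (LinearMap.range (Matrix.toLin' (projMat S f))) : ℝ) =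
      2 ^ i / Nat.card S := by
  have h : IsIdempotentElem (Matrix.toLin' (projMat S f)) := by
    rw [IsIdempotentElem, Module.End.mul_eq_comp, ← Matrix.toLin'_mul, projMat_mul_self]
  rw [← (LinearMap.IsIdempotentElem.isProj_range _ h).trace, Matrix.trace_toLin'_eq, trace_projMat]

/-- Symmetric idempotent matrices are determined by their range. -/
lemma eq_of_range_toLin'_eq {n : Type*} [Fintype n] [DecidableEq n] {A B : Matrix n n ℝ}
    (hA : A * A = A) (hB : B * B = B) (hA' : Aᵀ = A) (hB' : Bᵀ = B)
    (h : LinearMap.range (Matrix.toLin' A) = LinearMap.range (Matrix.toLin' B)) : A = B := by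
  have key : ∀ C D : Matrix n n ℝ, C * C = C →
      LinearMap.range (Matrix.toLin' D) ≤ LinearMap.range (Matrix.toLin' C) → C * D = D := by
    intro C D hC hle
    apply Matrix.toLin'.injective
    ext1 x
    ext1
    obtain ⟨y, hy⟩ := hle (LinearMap.mem_range_self (Matrix.toLin' D) (Pi.single x 1))
    simp only [LinearMap.comp_apply, LinearMap.single_apply, Matrix.toLin'_mul]
    rw [← hy, ← LinearMap.comp_apply, ← Matrix.toLin'_mul, hC]
  have h1 := key A B hA h.ge
  have h2 := key B A hB h.le
  rw [← hA', ← h2, Matrix.transpose_mul, hA', hB', h1]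

end projMat

lemma projMat_injective {S T : Submodule (ZMod 2) (U i × U i)} {f : SignFn S} {g : SignFn T}
    (h : projMat S f = projMat T g) :
    (⟨S, f⟩ : Σ S : Submodule (ZMod 2) (U i × U i), SignFn S) = ⟨T, g⟩ := by
  have h4 : (2 : ℝ) ^ i ≠ 0 := by positivity
  have mem : ∀ {S : Submodule (ZMod 2) (U i × U i)} (f : SignFn S) (q : U i × U i),
      q ∈ S ↔ (pauli q * projMat S f).trace ≠ 0 := by
    intro S f q
    have h1 := trace_pauli_mul_projMat f q
    have h2 := card_ne_zero S
    by_cases hq : q ∈ S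
    · simp only [hq, true_iff, dite_true] at h1 ⊢
      intro h0
      rw [h0, zero_mul] at h1
      exact mul_ne_zero (mul_ne_zero (sg_ne_zero _) h4) (sg_ne_zero _) h1.symm
    · simp only [hq, dite_false] at h1
      simpa [hq, h2] using h1
  have hST : S = T := by
    ext q
    rw [mem f, mem g, h]
  subst hST
  congr 1
  apply Subtype.ext
  ext p
  have h1 := trace_pauli_mul_projMat f p.1
  rw [h, trace_pauli_mul_projMat g p.1, dif_pos p.2, dif_pos p.2] at h1
  exact sg_injective (mul_left_cancel₀ (mul_ne_zero (sg_ne_zero _) h4) h1.symm)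

/-- The elements of `preim S` are uniquely of the form `signedPauli x p`. -/
noncomputable def signedEquiv (S : Submodule (ZMod 2) (U i × U i)) : ZMod 2 × S ≃ preim S :=
  Equiv.ofBijective (fun a => ⟨signedPauli a.1 a.2, signedPauli_mem a.1 a.2.2⟩) <| by
    constructor
    · rintro ⟨x, p⟩ ⟨y, q⟩ h
      have h' := signedPauli_injective (congrArg Subtype.val h)
      exact Prod.ext h'.1 (Subtype.ext h'.2)
    · rintro ⟨g, hg⟩
      obtain ⟨x, p, hp, rfl⟩ := mem_preim_iff.1 hg
      exact ⟨(x, ⟨p, hp⟩), rfl⟩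

section characters

variable {S : Submodule (ZMod 2) (U i × U i)}

lemma signedEquiv_val (a : ZMod 2 × S) :
    (signedEquiv S a : (Matrix (U i) (U i) ℝ)ˣ) = signedPauli a.1 a.2 := rfl

lemma signedEquiv_mul (a b : ZMod 2 × S) :
    signedEquiv S a * signedEquiv S b =
      signedEquiv S (a.1 + b.1 + dotp a.2.1.2 b.2.1.1, a.2 + b.2) :=
  Subtype.ext (signedPauli_mul _ _ _ _)

lemma sgUnit_add (x y : ZMod 2) : sgUnit (x + y) = sgUnit x * sgUnit y :=
  Units.ext (sg_add x y)

lemma sgUnit_injective : Function.Injective sgUnit := fun _ _ h =>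
  sg_injective (congrArg Units.val h)

lemma sgUnit_one : sgUnit 1 = -1 := by
  ext
  simp [sgUnit]

lemma PiMat_eq_projMat (f : SignFn S) (χ : preim S →* ℝˣ)
    (h : ∀ a, χ (signedEquiv S a) = sgUnit (a.1 + f.1 a.2)) :
    PiMat (preim S) χ = projMat S f := by
  have hfin : Finite (preim S) := Finite.of_equiv _ (signedEquiv S)
  have hcard : Nat.card (preim S) = 2 * Nat.card S := by
    rw [← Nat.card_congr (signedEquiv S), Nat.card_prod, Nat.card_zmod]
  rw [PiMat, projMat, hcard, ← finsum_comp_equiv (signedEquiv S), finsum_eq_sum_of_fintype,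
    Fintype.sum_prod_type_right]
  have : ∀ (p : S) (x : ZMod 2), (χ (signedEquiv S (x, p)) : ℝ) •
      ((signedEquiv S (x, p) : (Matrix (U i) (U i) ℝ)ˣ) : Matrix (U i) (U i) ℝ) =
      sg (f.1 p) • pauli p.1 := by
    intro p x
    rw [h, signedEquiv_val, signedPauli_val, smul_smul]
    simp only [sgUnit, Units.val_mk0]
    rw [sg_add, mul_right_comm, sg_mul_self, one_mul]
  simp only [this, Finset.sum_const, Finset.card_univ, ZMod.card]
  rw [← Finset.smul_sum, ← Nat.cast_smul_eq_nsmul ℝ, smul_smul]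
  congr 1
  have := card_ne_zero S
  push_cast
  field_simp

/-- The character of `preim S` attached to a sign function. -/
noncomputable def SignFn.character (f : SignFn S) : preim S →* ℝˣ :=
  MonoidHom.mk' (fun g => sgUnit (((signedEquiv S).symm g).1 + f.1 ((signedEquiv S).symm g).2)) <| by
    intro g h
    obtain ⟨a, rfl⟩ := (signedEquiv S).surjective g
    obtain ⟨b, rfl⟩ := (signedEquiv S).surjective h
    simp only [signedEquiv_mul, Equiv.symm_apply_apply, ← sgUnit_add, f.2]
    congr 1
    linear_combination CharTwo.add_self_eq_zero (dotp a.2.1.2 b.2.1.1)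

lemma SignFn.character_signedEquiv (f : SignFn S) (a : ZMod 2 × S) :
    f.character (signedEquiv S a) = sgUnit (a.1 + f.1 a.2) := by
  simp [SignFn.character]

lemma signedEquiv_one_zero :
    ((signedEquiv S (1, 0) : (Matrix (U i) (U i) ℝ)ˣ) : Matrix (U i) (U i) ℝ) = -1 := by
  simp [signedEquiv_val, signedPauli_val]

lemma SignFn.character_neg_one (f : SignFn S) (m : preim S)
    (hm : ((m : (Matrix (U i) (U i) ℝ)ˣ) : Matrix (U i) (U i) ℝ) = -1) : f.character m = -1 := by
  have : m = signedEquiv S (1, 0) := Subtype.ext (Units.ext (hm.trans signedEquiv_one_zero.symm))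
  rw [this, f.character_signedEquiv, f.map_zero, add_zero, sgUnit_one]

lemma exists_signFn (χ : preim S →* ℝˣ) (h1 : ∀ s : preim S, (χ s : ℝ) = 1 ∨ (χ s : ℝ) = -1)
    (h2 : ∀ m : preim S,
      ((m : (Matrix (U i) (U i) ℝ)ˣ) : Matrix (U i) (U i) ℝ) = -1 → χ m = -1) :
    ∃ f : SignFn S, ∀ a, χ (signedEquiv S a) = sgUnit (a.1 + f.1 a.2) := by
  have h3 : ∀ p : S, ∃ x, χ (signedEquiv S (0, p)) = sgUnit x := by
    intro p
    rcases h1 (signedEquiv S (0, p)) with h | h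
    · exact ⟨0, Units.ext (by simpa [sgUnit] using h)⟩
    · exact ⟨1, Units.ext (by simpa [sgUnit] using h)⟩
  choose f hf using h3
  have h4 : ∀ x, χ (signedEquiv S (x, 0)) = sgUnit x := by
    intro x
    rcases zmod_two_cases x with rfl | rfl
    · have : signedEquiv S (0, 0) = 1 := Subtype.ext signedPauli_zero
      rw [this, map_one]
      exact Units.ext (by simp [sgUnit])
    · rw [h2 _ signedEquiv_one_zero, sgUnit_one]
  have h5 : ∀ a, χ (signedEquiv S a) = sgUnit (a.1 + f a.2) := by
    rintro ⟨x, p⟩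
    have := signedEquiv_mul (S := S) (x, 0) (0, p)
    simp only [add_zero, zero_add, ZeroMemClass.coe_zero, Prod.snd_zero, dotp_zero_left] at this
    rw [← this, map_mul, h4, hf, sgUnit_add]
  refine ⟨⟨f, fun p q => ?_⟩, h5⟩
  have h6 := congrArg χ (signedEquiv_mul (0, p) (0, q))
  rw [map_mul, h5, h5, h5, ← sgUnit_add] at h6
  have h7 := sgUnit_injective h6
  simp only [zero_add] at h7
  linear_combination -h7 - CharTwo.add_self_eq_zero (dotp p.1.2 q.1.1)

end characters

section counting

/-- The polar form of the quadratic form `(a, b) ↦ a · b`. -/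
def polarForm (p q : U i × U i) : ZMod 2 := dotp p.2 q.1 + dotp q.2 p.1

lemma polarForm_add_left (p q r : U i × U i) :
    polarForm (p + q) r = polarForm p r + polarForm q r := by
  simp only [polarForm, Prod.snd_add, Prod.fst_add, dotp_add_left, dotp_add_right]
  ring

lemma polarForm_add_right (p q r : U i × U i) :
    polarForm p (q + r) = polarForm p q + polarForm p r := by
  simp only [polarForm, Prod.snd_add, Prod.fst_add, dotp_add_left, dotp_add_right]
  ring

lemma dotp_add_add (p q : U i × U i) :
    dotp (p + q).1 (p + q).2 = dotp p.1 p.2 + dotp q.1 q.2 + polarForm p q := by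
  simp only [polarForm, Prod.snd_add, Prod.fst_add, dotp_add_left, dotp_add_right,
    dotp_comm p.2, dotp_comm q.2]
  ring

lemma TotSing.polarForm_eq_zero {S : Submodule (ZMod 2) (U i × U i)} (hS : TotSing S)
    {p q : U i × U i} (hp : p ∈ S) (hq : q ∈ S) : polarForm p q = 0 := by
  have h := dotp_add_add p q
  rw [hS _ (S.add_mem hp hq), hS _ hp, hS _ hq] at h
  simpa using h.symm

lemma exists_polarForm_ne_zero {p : U i × U i} (hp : p ≠ 0) : ∃ q, polarForm p q ≠ 0 := by
  by_cases h : p.2 = 0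
  · have h1 : p.1 ≠ 0 := fun h1 => hp (Prod.ext h1 h)
    obtain ⟨b, hb⟩ := exists_dotp_ne_zero h1
    exact ⟨(0, b), by simpa [polarForm, dotp_comm b] using hb⟩
  · obtain ⟨a, ha⟩ := exists_dotp_ne_zero h
    exact ⟨(a, 0), by simpa [polarForm] using ha⟩

/-- In characteristic two, every alternating bilinear form is the polarization of a function. -/
lemma exists_polarization {W : Type*} [AddCommGroup W] [Module (ZMod 2) W] [Module.Finite (ZMod 2) W]
    (β : LinearMap.BilinForm (ZMod 2) W) (hβ : ∀ p, β p p = 0) :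
    ∃ f : W → ZMod 2, ∀ p q, f (p + q) = f p + f q + β p q := by
  have hsymm : ∀ p q, β p q = β q p := by
    intro p q
    have h := hβ (p + q)
    simp only [map_add, LinearMap.add_apply, hβ, zero_add, add_zero] at h
    linear_combination h - CharTwo.add_self_eq_zero (β q p)
  let b := Module.finBasis (ZMod 2) W
  let B : LinearMap.BilinForm (ZMod 2) W :=
    b.constr (ZMod 2) fun j => b.constr (ZMod 2) fun l => if j < l then β (b j) (b l) else 0
  have hB : ∀ j l, B (b j) (b l) = if j < l then β (b j) (b l) else 0 := by
    intro j l
    simp only [B, Module.Basis.constr_basis]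
  have h : β = B + LinearMap.BilinForm.flip B := by
    refine LinearMap.BilinForm.ext_basis b fun j l => ?_
    rw [LinearMap.BilinForm.add_apply, LinearMap.BilinForm.flip_apply, hB, hB]
    rcases lt_trichotomy j l with h | h | h
    · simp [h, h.not_gt]
    · simp [h, hβ]
    · simp [h, h.not_gt, hsymm (b j)]
  refine ⟨fun p => B p p, fun p q => ?_⟩
  rw [h, LinearMap.BilinForm.add_apply, LinearMap.BilinForm.flip_apply]
  simp only [map_add, LinearMap.add_apply]
  ring

lemma card_signFn {S : Submodule (ZMod 2) (U i × U i)} (hS : TotSing S) :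
    Nat.card (SignFn S) = 2 ^ Module.finrank (ZMod 2) S := by
  let β : LinearMap.BilinForm (ZMod 2) S := LinearMap.mk₂ (ZMod 2) (fun p q => dotp p.1.2 q.1.1)
    (fun p q r => dotp_add_left _ _ _) (fun x p q => dotp_smul_left _ _ _)
    (fun p q r => dotp_add_right _ _ _) (fun x p q => dotp_smul_right _ _ _)
  obtain ⟨f₀, hf₀⟩ := exists_polarization β fun p => (dotp_comm _ _).trans (hS p.1 p.2)
  let e : SignFn S ≃ Module.Dual (ZMod 2) S :=
    { toFun := fun f => AddMonoidHom.toZModLinearMap 2 (AddMonoidHom.mk' (fun p => f.1 p - f₀ p) (by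
        intro p q
        rw [f.2, hf₀]
        simp only [β, LinearMap.mk₂_apply]
        ring))
      invFun := fun g => ⟨fun p => g p + f₀ p, by
        intro p q
        change g (p + q) + f₀ (p + q) = g p + f₀ p + (g q + f₀ q) + _
        rw [map_add, hf₀]
        simp only [β, LinearMap.mk₂_apply]
        ring⟩
      left_inv := fun f => by
        ext p
        simp
      right_inv := fun g => by
        ext p
        simp }
  rw [Nat.card_congr e, Module.natCard_eq_pow_finrank (K := ZMod 2), Nat.card_zmod,
    Subspace.dual_finrank_eq]

lemma sum_sg_quadratic : ∑ p : U i × U i, sg (dotp p.1 p.2) = 2 ^ i := by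
  rw [Fintype.sum_prod_type]
  simp [sum_sg_dotp]

lemma sum_sg_polarForm (p : U i × U i) :
    ∑ x, sg (polarForm p x) = if p = 0 then (2 ^ i * 2 ^ i : ℝ) else 0 := by
  split_ifs with hp
  · subst hp
    simp [polarForm, ZMod.card]
  · obtain ⟨q, hq⟩ := exists_polarForm_ne_zero hp
    exact sum_sg_eq_zero (AddMonoidHom.mk' (polarForm p) (polarForm_add_right p)) (x := q) hq

open Classical in
lemma sum_sg_polarForm_submodule (S : Submodule (ZMod 2) (U i × U i)) (x : U i × U i) :
    ∑ p : S, sg (polarForm p.1 x) = Nat.card S * if ∀ p ∈ S, polarForm p x = 0 then 1 else 0 := by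
  split_ifs with h
  · rw [Finset.sum_congr rfl fun p _ => by rw [h p.1 p.2, sg_zero]]
    simp
  · push Not at h
    obtain ⟨q, hq, hqx⟩ := h
    rw [mul_zero]
    exact sum_sg_eq_zero (AddMonoidHom.mk' (fun p : S => polarForm p.1 x)
      fun p q => polarForm_add_left p.1 q.1 x) (x := ⟨q, hq⟩) hqx

/-- The vectors which extend a totally singular subspace `S` to one of dimension one more. -/
def extensions (S : Submodule (ZMod 2) (U i × U i)) : Set (U i × U i) :=
  {x | x ∉ S ∧ dotp x.1 x.2 = 0 ∧ ∀ p ∈ S, polarForm p x = 0}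

lemma card_extensions {S : Submodule (ZMod 2) (U i × U i)} (hS : TotSing S) :
    (Nat.card (extensions S) : ℝ) = (2 ^ i * 2 ^ i / Nat.card S + 2 ^ i) / 2 - Nat.card S := by
  classical
  have hc := card_ne_zero S
  let ind : U i × U i → ℝ := fun x => if ∀ p ∈ S, polarForm p x = 0 then 1 else 0
  have h1 : ∑ x, ind x = 2 ^ i * 2 ^ i / Nat.card S := by
    rw [eq_div_iff hc, mul_comm, Finset.mul_sum]
    simp only [ind, ← sum_sg_polarForm_submodule]
    rw [Finset.sum_comm, Finset.sum_eq_single 0]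
    · simp [sum_sg_polarForm]
    · intro p _ hp
      rw [sum_sg_polarForm, if_neg fun h : p.1 = 0 => hp (Subtype.ext h)]
    · simp
  have h2 : ∑ x, ind x * sg (dotp x.1 x.2) = 2 ^ i := by
    refine mul_left_cancel₀ hc ?_
    rw [Finset.mul_sum]
    simp only [ind, ← mul_assoc, ← sum_sg_polarForm_submodule, Finset.sum_mul]
    rw [Finset.sum_comm]
    have : ∀ p : S, ∑ x : U i × U i, sg (polarForm p.1 x) * sg (dotp x.1 x.2) = 2 ^ i := by
      intro p
      rw [← sum_sg_quadratic]
      refine Fintype.sum_equiv (Equiv.addLeft p.1) _ _ fun x => ?_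
      rw [Equiv.coe_addLeft, dotp_add_add, hS p.1 p.2, zero_add, sg_add, mul_comm]
    simp [this]
  have h3 : ∑ x : U i × U i, (if x ∈ S then (1 : ℝ) else 0) = Nat.card S := by
    rw [Finset.sum_boole, Nat.card_eq_fintype_card, Fintype.card_subtype]
  have h4 : (Nat.card (extensions S) : ℝ) = ∑ x, if x ∈ extensions S then (1 : ℝ) else 0 := by
    rw [Finset.sum_boole, Nat.card_eq_fintype_card, Fintype.card_subtype]
  rw [h4, ← h1, ← h3, ← h2, ← Finset.sum_add_distrib, Finset.sum_div, ← Finset.sum_sub_distrib]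
  refine Finset.sum_congr rfl fun x _ => ?_
  by_cases hx : x ∈ S
  · have h5 : ∀ p ∈ S, polarForm p x = 0 := fun p hp => hS.polarForm_eq_zero hp hx
    have h6 : x ∉ extensions S := fun h => h.1 hx
    have h7 : ind x = 1 := if_pos h5
    simp [h7, hx, h6, hS x hx]
  · by_cases h5 : ∀ p ∈ S, polarForm p x = 0
    · have h6 : x ∈ extensions S ↔ dotp x.1 x.2 = 0 := ⟨fun h => h.2.1, fun h => ⟨hx, h, h5⟩⟩
      have h7 : ind x = 1 := if_pos h5
      rcases zmod_two_cases (dotp x.1 x.2) with h | h <;> simp [h7, hx, h6, h]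
    · have h6 : x ∉ extensions S := fun h => h5 h.2.2
      have h7 : ind x = 0 := if_neg h5
      simp [h7, h6, hx]

/-- Linearly independent tuples with totally singular span. -/
def IsSingularTuple {m : ℕ} (s : Fin m → U i × U i) : Prop :=
  LinearIndependent (ZMod 2) s ∧ TotSing (Submodule.span (ZMod 2) (Set.range s))

lemma totSing_span_insert {t : Set (U i × U i)} {x : U i × U i} :
    TotSing (Submodule.span (ZMod 2) (insert x t)) ↔
      TotSing (Submodule.span (ZMod 2) t) ∧ dotp x.1 x.2 = 0 ∧
        ∀ p ∈ Submodule.span (ZMod 2) t, polarForm p x = 0 := by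
  constructor
  · intro h
    have hx := Submodule.subset_span (R := ZMod 2) (Set.mem_insert x t)
    have ht := Submodule.span_mono (R := ZMod 2) (Set.subset_insert x t)
    exact ⟨fun p hp => h p (ht hp), h x hx, fun p hp => h.polarForm_eq_zero (ht hp) hx⟩
  · rintro ⟨h1, h2, h3⟩ p hp
    obtain ⟨c, q, hq, rfl⟩ := Submodule.mem_span_insert.1 hp
    rw [add_comm]
    rcases zmod_two_cases c with rfl | rfl
    · simpa using h1 q hq
    · rw [one_smul, dotp_add_add, h1 q hq, h2, h3 q hq, add_zero, add_zero]

lemma isSingularTuple_cons {m : ℕ} {x : U i × U i} {s : Fin m → U i × U i} :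
    IsSingularTuple (Fin.cons x s : Fin (m + 1) → U i × U i) ↔
      IsSingularTuple s ∧ x ∈ extensions (Submodule.span (ZMod 2) (Set.range s)) := by
  rw [IsSingularTuple, linearIndependent_finCons, Fin.range_cons, totSing_span_insert,
    IsSingularTuple, extensions, Set.mem_ofPred_eq]
  tauto

/-- A singular tuple of length `m + 1` is a singular tuple of length `m` and an extension. -/
def singularTupleEquiv (i m : ℕ) :
    {s : Fin (m + 1) → U i × U i // IsSingularTuple s} ≃
      Σ s : {s : Fin m → U i × U i // IsSingularTuple s},
        extensions (Submodule.span (ZMod 2) (Set.range s.1)) where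
  toFun s :=
    have h := isSingularTuple_cons.1 ((Fin.cons_self_tail s.1).symm ▸ s.2)
    ⟨⟨Fin.tail s.1, h.1⟩, ⟨s.1 0, h.2⟩⟩
  invFun s := ⟨Fin.cons s.2.1 s.1.1, isSingularTuple_cons.2 ⟨s.1.2, s.2.2⟩⟩
  left_inv s := Subtype.ext (Fin.cons_self_tail s.1)
  right_inv _ := rfl

lemma card_singularTuple (i m : ℕ) :
    (Nat.card {s : Fin m → U i × U i // IsSingularTuple s} : ℝ) =
      ∏ j ∈ Finset.range m, ((2 ^ i * 2 ^ i / 2 ^ j + 2 ^ i) / 2 - 2 ^ j) := by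
  classical
  induction m with
  | zero =>
    have h : IsSingularTuple (default : Fin 0 → U i × U i) := by
      refine ⟨linearIndependent_empty_type, ?_⟩
      rw [Set.range_eq_empty, Submodule.span_empty]
      rintro p hp
      rw [(Submodule.mem_bot _).1 hp]
      simp
    have : Unique {s : Fin 0 → U i × U i // IsSingularTuple s} :=
      ⟨⟨⟨default, h⟩⟩, fun s => Subtype.ext (Subsingleton.elim _ _)⟩
    simp
  | succ m ih =>
    rw [Nat.card_congr (singularTupleEquiv i m), Nat.card_sigma, Nat.cast_sum,
      Finset.prod_range_succ, ← ih]
    have : ∀ s : {s : Fin m → U i × U i // IsSingularTuple s},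
        (Nat.card (extensions (Submodule.span (ZMod 2) (Set.range s.1))) : ℝ) =
          (2 ^ i * 2 ^ i / 2 ^ m + 2 ^ i) / 2 - 2 ^ m := by
      intro s
      rw [card_extensions s.2.2, card_submodule, finrank_span_eq_card s.2.1, Fintype.card_fin]
      push_cast
      rfl
    rw [Finset.sum_congr rfl fun s _ => this s, Finset.sum_const, Finset.card_univ, nsmul_eq_mul,
      Nat.card_eq_fintype_card]

/-- Totally singular subspaces of dimension `m`. -/
abbrev SingularSubspace (i m : ℕ) : Type :=
  {S : Submodule (ZMod 2) (U i × U i) // Module.finrank (ZMod 2) S = m ∧ TotSing S}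

lemma span_range_coe_eq {m : ℕ} {S : Submodule (ZMod 2) (U i × U i)} (s : Fin m → S)
    (hS : Module.finrank (ZMod 2) S = m) (hs : LinearIndependent (ZMod 2) s) :
    Submodule.span (ZMod 2) (Set.range fun j => (s j : U i × U i)) = S := by
  refine Submodule.eq_of_le_of_finrank_eq ?_ ?_
  · rw [Submodule.span_le]
    rintro _ ⟨j, rfl⟩
    exact (s j).2
  · have h := finrank_span_eq_card (hs.map' S.subtype (Submodule.ker_subtype S))
    exact h.trans ((Fintype.card_fin m).trans hS.symm)

/-- A singular tuple is the same as a totally singular subspace with an ordered basis. -/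
lemma card_singularTuple_eq (i m : ℕ) :
    Nat.card {s : Fin m → U i × U i // IsSingularTuple s} =
      Nat.card (Σ S : SingularSubspace i m, {s : Fin m → S.1 // LinearIndependent (ZMod 2) s}) := by
  let e : (Σ S : SingularSubspace i m, {s : Fin m → S.1 // LinearIndependent (ZMod 2) s}) →
      {s : Fin m → U i × U i // IsSingularTuple s} := fun a =>
    ⟨fun j => a.2.1 j, a.2.2.map' a.1.1.subtype (Submodule.ker_subtype a.1.1), by
      rw [span_range_coe_eq a.2.1 a.1.2.1 a.2.2]
      exact a.1.2.2⟩
  have he : Function.Bijective e := by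
    constructor
    · rintro ⟨⟨S, hS⟩, s, hs⟩ ⟨⟨T, hT⟩, t, ht⟩ h
      have h1 : (fun j => (s j : U i × U i)) = fun j => (t j : U i × U i) := congrArg Subtype.val h
      have h2 : S = T := (span_range_coe_eq s hS.1 hs).symm.trans <|
        (congrArg (fun r => Submodule.span (ZMod 2) (Set.range r)) h1).trans
          (span_range_coe_eq t hT.1 ht)
      subst h2
      have h3 : s = t := by
        ext1 j
        exact Subtype.ext (congrFun h1 j)
      subst h3
      rfl
    · rintro ⟨s, hs, hs'⟩
      refine ⟨⟨⟨_, (finrank_span_eq_card hs).trans (Fintype.card_fin m), hs'⟩,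
        ⟨_, linearIndependent_span hs⟩⟩, rfl⟩
  exact (Nat.card_congr (Equiv.ofBijective e he)).symm

lemma card_singularSubspace_mul (i m : ℕ) :
    (Nat.card (SingularSubspace i m) : ℝ) * ∏ j ∈ Finset.range m, (2 ^ m - 2 ^ j : ℝ) =
      ∏ j ∈ Finset.range m, ((2 ^ i * 2 ^ i / 2 ^ j + 2 ^ i) / 2 - 2 ^ j) := by
  classical
  have hfin : Finite (SingularSubspace i m) := Subtype.finite
  have := Fintype.ofFinite (SingularSubspace i m)
  rw [← card_singularTuple]
  rw [card_singularTuple_eq, Nat.card_sigma]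
  have hcard : ∀ S : SingularSubspace i m,
      Nat.card {s : Fin m → S.1 // LinearIndependent (ZMod 2) s} =
        ∏ j : Fin m, (2 ^ m - 2 ^ (j : ℕ)) := by
    intro S
    rw [card_linearIndependent S.2.1.ge, ZMod.card, S.2.1]
  rw [Finset.sum_congr rfl fun S _ => hcard S, Finset.sum_const, Finset.card_univ,
    ← Nat.card_eq_fintype_card, smul_eq_mul, Nat.cast_mul, Nat.cast_prod, Finset.prod_range]
  congr 1
  refine Finset.prod_congr rfl fun j _ => ?_
  rw [Nat.cast_sub (Nat.pow_le_pow_right two_pos j.2.le)]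
  push_cast
  rfl

lemma prod_two_pow_sub_one_add (k m : ℕ) :
    ∏ j ∈ Finset.range (k + m), ((2 : ℝ) ^ (k + m - j) - 1) =
      (∏ j ∈ Finset.range k, ((2 : ℝ) ^ (k + m - j) - 1)) *
        ∏ j ∈ Finset.range m, ((2 : ℝ) ^ (m - j) - 1) := by
  rw [Finset.prod_range_add]
  simp only [Nat.add_sub_add_left]

lemma prod_two_pow_sub_one_ne_zero (k : ℕ) :
    ∏ j ∈ Finset.range k, ((2 : ℝ) ^ (k - j) - 1) ≠ 0 := by
  refine Finset.prod_ne_zero_iff.2 fun j hj => ?_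
  have : (1 : ℝ) < 2 ^ (k - j) := one_lt_pow₀ one_lt_two (by
    have := Finset.mem_range.1 hj
    omega)
  linarith

lemma card_singularSubspace (k m : ℕ) :
    (Nat.card (SingularSubspace (k + m) m) : ℝ) =
      (∏ j ∈ Finset.range k, ((2 : ℝ) ^ (k + m - j) - 1)) /
        (∏ j ∈ Finset.range k, ((2 : ℝ) ^ (k - j) - 1)) *
      ∏ j ∈ Finset.Ico k (k + m), ((2 : ℝ) ^ j + 1) := by
  have h := card_singularSubspace_mul (k + m) m
  have h1 : ∏ j ∈ Finset.range m, (2 ^ m - 2 ^ j : ℝ) =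
      (∏ j ∈ Finset.range m, (2 : ℝ) ^ j) * ∏ j ∈ Finset.range m, ((2 : ℝ) ^ (m - j) - 1) := by
    rw [← Finset.prod_mul_distrib]
    refine Finset.prod_congr rfl fun j hj => ?_
    rw [mul_sub, ← pow_add, Nat.add_sub_cancel' (Finset.mem_range.1 hj).le, mul_one]
  have h2 : ∏ j ∈ Finset.range m, ((2 ^ (k + m) * 2 ^ (k + m) / 2 ^ j + 2 ^ (k + m)) / 2 - 2 ^ j) =
      (∏ j ∈ Finset.range m, (2 : ℝ) ^ j) * (∏ j ∈ Finset.range m, ((2 : ℝ) ^ (m + k - j) - 1)) *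
        ∏ j ∈ Finset.Ico k (k + m), ((2 : ℝ) ^ j + 1) := by
    rw [Finset.prod_Ico_eq_prod_range, Nat.add_sub_cancel_left,
      ← Finset.prod_range_reflect (fun j => (2 : ℝ) ^ (k + j) + 1), ← Finset.prod_mul_distrib,
      ← Finset.prod_mul_distrib]
    refine Finset.prod_congr rfl fun j hj => ?_
    obtain ⟨n, rfl⟩ := Nat.exists_eq_add_of_lt (Finset.mem_range.1 hj)
    rw [show j + n + 1 + k - j = n + k + 1 by omega, show k + (j + n + 1 - 1 - j) = n + k by omega,
      show k + (j + n + 1) = j + (n + k) + 1 by omega]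
    have : (2 : ℝ) ^ j ≠ 0 := by positivity
    simp only [pow_succ, pow_add _ j]
    field_simp
    ring
  have h3 := prod_two_pow_sub_one_add k m
  have h4 := prod_two_pow_sub_one_add m k
  rw [add_comm m k] at h4
  rw [h4] at h3
  rw [h1, h2, add_comm m k] at h
  have h5 : ∏ j ∈ Finset.range m, (2 : ℝ) ^ j ≠ 0 :=
    Finset.prod_ne_zero_iff.2 fun j _ => by positivity
  have h6 := prod_two_pow_sub_one_ne_zero k
  have h7 := prod_two_pow_sub_one_ne_zero m
  rw [div_mul_eq_mul_div, eq_div_iff h6]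
  refine mul_left_cancel₀ (mul_ne_zero h5 h7) ?_
  linear_combination (∏ j ∈ Finset.range k, ((2 : ℝ) ^ (k - j) - 1)) * h +
    (∏ j ∈ Finset.range m, (2 : ℝ) ^ j) * (∏ j ∈ Finset.Ico k (k + m), ((2 : ℝ) ^ j + 1)) * h3

end counting

/-- The ranges of the projections attached to `preim S` and its characters are those of the
matrices `projMat S f`. -/
lemma setOf_range_PiMat_eq (i m : ℕ) :
    {W : Submodule ℝ (U i → ℝ) |
        ∃ S : Submodule (ZMod 2) (U i × U i),
          Module.finrank (ZMod 2) S = m ∧ TotSing S ∧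
          ∃ χ : preim S →* ℝˣ,
            (∀ s : preim S, (χ s : ℝ) = 1 ∨ (χ s : ℝ) = -1) ∧
            (∀ m : preim S,
              ((m : (Matrix (U i) (U i) ℝ)ˣ) : Matrix (U i) (U i) ℝ) = -1 → χ m = -1) ∧
            W = LinearMap.range (Matrix.toLin' (PiMat (preim S) χ))} =
      Set.range fun a : Σ S : SingularSubspace i m, SignFn S.1 =>
        LinearMap.range (Matrix.toLin' (projMat a.1.1 a.2)) := by
  ext W
  constructor
  · rintro ⟨S, hm, hS, χ, h1, h2, rfl⟩
    obtain ⟨f, hf⟩ := exists_signFn χ h1 h2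
    exact ⟨⟨⟨S, hm, hS⟩, f⟩, by rw [PiMat_eq_projMat f χ hf]⟩
  · rintro ⟨⟨⟨S, hm, hS⟩, f⟩, rfl⟩
    refine ⟨S, hm, hS, f.character, fun s => sg_eq_one_or _, f.character_neg_one, ?_⟩
    rw [PiMat_eq_projMat f _ f.character_signedEquiv]

lemma range_projMat_injective (i m : ℕ) :
    Function.Injective fun a : Σ S : SingularSubspace i m, SignFn S.1 =>
      LinearMap.range (Matrix.toLin' (projMat a.1.1 a.2)) := by
  rintro ⟨⟨S, hm, hS⟩, f⟩ ⟨⟨T, hm', hT⟩, g⟩ h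
  have h1 := projMat_injective (eq_of_range_toLin'_eq (projMat_mul_self f) (projMat_mul_self g)
    (projMat_transpose hS f) (projMat_transpose hT g) h)
  cases h1
  rfl

lemma card_sigma_signFn (i m : ℕ) :
    Nat.card (Σ S : SingularSubspace i m, SignFn S.1) =
      Nat.card (SingularSubspace i m) * 2 ^ m := by
  have hfin : Finite (SingularSubspace i m) := Subtype.finite
  have := Fintype.ofFinite (SingularSubspace i m)
  rw [Nat.card_sigma, Finset.sum_congr rfl fun S _ => (card_signFn S.2.2).trans (by rw [S.2.1])]
  simp [Nat.card_eq_fintype_card]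

end

/-- the set of all ranges `range(Π(S,χ))`, over all preimages `S` of
    totally singular `(i−k)`-dimensional subspaces `S̄` and all characters `χ` of `S`
    with values `±1` and `χ(−I) = −1`, consists of `2^k`-dimensional subspaces of `V`,
    and has cardinality `N = 2^{i−k} · [i choose k]₂ · Π_{j=k}^{i−1}(2^j + 1)`. -/
theorem stmt11 (i k : ℕ) (hi : 0 < i) (hk : k ≤ i - 1) :
    (∀ W ∈ {W : Submodule ℝ (U i → ℝ) |
        ∃ S : Submodule (ZMod 2) (U i × U i),
          Module.finrank (ZMod 2) S = i - k ∧ TotSing S ∧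
          ∃ χ : preim S →* ℝˣ,
            (∀ s : preim S, (χ s : ℝ) = 1 ∨ (χ s : ℝ) = -1) ∧
            (∀ m : preim S,
              ((m : (Matrix (U i) (U i) ℝ)ˣ) : Matrix (U i) (U i) ℝ) = -1 → χ m = -1) ∧
            W = LinearMap.range (Matrix.toLin' (PiMat (preim S) χ))},
      Module.finrank ℝ W = 2 ^ k) ∧
    (Nat.card {W : Submodule ℝ (U i → ℝ) |
        ∃ S : Submodule (ZMod 2) (U i × U i),
          Module.finrank (ZMod 2) S = i - k ∧ TotSing S ∧
          ∃ χ : preim S →* ℝˣ,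
            (∀ s : preim S, (χ s : ℝ) = 1 ∨ (χ s : ℝ) = -1) ∧
            (∀ m : preim S,
              ((m : (Matrix (U i) (U i) ℝ)ˣ) : Matrix (U i) (U i) ℝ) = -1 → χ m = -1) ∧
            W = LinearMap.range (Matrix.toLin' (PiMat (preim S) χ))} : ℚ) =
      2 ^ (i - k) *
      ((∏ j ∈ Finset.range k, ((2 : ℚ) ^ (i - j) - 1)) /
        (∏ j ∈ Finset.range k, ((2 : ℚ) ^ (k - j) - 1))) *
      (∏ j ∈ Finset.Ico k i, ((2 : ℚ) ^ j + 1)) := by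
  obtain ⟨m, rfl⟩ : ∃ m, i = k + m := ⟨i - k, by omega⟩
  rw [Nat.add_sub_cancel_left, setOf_range_PiMat_eq]
  constructor
  · rintro _ ⟨⟨⟨S, hm, hS⟩, f⟩, rfl⟩
    have h : (Module.finrank ℝ (LinearMap.range (Matrix.toLin' (projMat S f))) : ℝ) =
        2 ^ (k + m) / Nat.card S := finrank_range_projMat f
    rw [card_submodule, hm, pow_add] at h
    push_cast at h
    rw [mul_div_cancel_right₀ _ (by positivity)] at h
    exact_mod_cast h
  · rw [Nat.card_congr (Equiv.ofInjective _ (range_projMat_injective (k + m) m)).symm,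
      card_sigma_signFn]
    have h := card_singularSubspace k m
    have h' : (Nat.card (SingularSubspace (k + m) m) : ℚ) =
        (∏ j ∈ Finset.range k, ((2 : ℚ) ^ (k + m - j) - 1)) /
          (∏ j ∈ Finset.range k, ((2 : ℚ) ^ (k - j) - 1)) *
        ∏ j ∈ Finset.Ico k (k + m), ((2 : ℚ) ^ j + 1) := by
      apply Rat.cast_injective (α := ℝ)
      push_cast
      exact h
    push_cast
    rw [h']
    ring
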